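/- Every finite tree on n ≥ 2 vertices contains a vertex u (a centroid) such that every connected component of the graph obtained from the tree by deleting u has at most ⌊n/2⌋ vertices. Equivalently, splitting the tree at u — replacing u by one copy for each edge incident to u — yields trees each having at most (n+1)/2 edges. -/

import Mathlib

namespace SimpleGraph

variable {V : Type*} {G : SimpleGraph V}

/-- In an acyclic graph the length of any path is the distance between its endpoints. -/
lemma IsAcyclic.length_eq_dist_of_isPath (hG : G.IsAcyclic) {u v : V} {p : G.Walk u v}
    (hp : p.IsPath) : p.length = G.dist u v := by
  obtain ⟨q, hq, hqd⟩ := p.reachable.exists_path_of_dist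
  have h := (hG.subsingleton_path u v).elim ⟨p, hp⟩ ⟨q, hq⟩
  rw [← hqd, Subtype.mk.inj h]

/-- In a connected graph, every component left after deleting a vertex contains a neighbor of
that vertex. -/
lemma Connected.exists_adj_mem_supp_induce_ne (hG : G.Connected) (u : V)
    (c : (G.induce {v : V | v ≠ u}).ConnectedComponent) :
    ∃ v : {v : V | v ≠ u}, G.Adj u v ∧ v ∈ c.supp := by
  obtain ⟨⟨w, hwu⟩, hw⟩ := c.nonempty_supp
  obtain ⟨p, hp⟩ := hG.exists_isPath u w
  cases p with
  | nil => exact absurd rfl hwu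
  | @cons _ v _ h q =>
    rw [Walk.cons_isPath_iff] at hp
    have hq : ∀ x ∈ q.support, x ∈ {v : V | v ≠ u} := by
      rintro x hx rfl
      exact hp.2 hx
    refine ⟨⟨v, h.ne'⟩, h, ?_⟩
    exact (ConnectedComponent.sound (q.induce _ hq).reachable).trans hw

/-- In an acyclic graph, moving from a vertex to a neighbor brings one closer to all the vertices
connected to that neighbor after the deletion of the first vertex. -/
lemma IsAcyclic.dist_add_one_le_of_reachable_induce_ne (hG : G.IsAcyclic) {u : V}
    {v w : {v : V | v ≠ u}} (huv : G.Adj u v) (h : (G.induce {v : V | v ≠ u}).Reachable v w) :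
    G.dist v w + 1 ≤ G.dist u w := by
  obtain ⟨p, hp⟩ := h.exists_isPath
  let q : G.Walk v w := p.map (Embedding.induce (G := G) {v : V | v ≠ u}).toHom
  have hq : q.IsPath := hp.map Subtype.val_injective
  have hu : u ∉ q.support := by
    intro h
    obtain ⟨x, -, hx⟩ := List.mem_map.mp ((Walk.support_map _ p) ▸ h)
    exact x.2 hx
  rw [← hG.length_eq_dist_of_isPath (hq.cons (h := huv) hu), Walk.length_cons]
  exact Nat.succ_le_succ (dist_le q)

end SimpleGraph

/-- Every finite tree on `n ≥ 2` vertices contains a centroid: a vertex `u` such that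
every connected component of the graph obtained from the tree by deleting `u`
has at most `⌊n/2⌋` vertices. -/
theorem tree_exists_centroid {V : Type*} [Fintype V] (G : SimpleGraph V)
    (hG : G.IsTree) (hn : 2 ≤ Fintype.card V) :
    ∃ u : V, ∀ c : (G.induce {v : V | v ≠ u}).ConnectedComponent,
      Nat.card c.supp ≤ Fintype.card V / 2 := by
  classical
  have := hG.connected.nonempty
  -- A vertex minimizing the sum of distances is a centroid.
  obtain ⟨u, hu⟩ := Finite.exists_min fun u ↦ ∑ w, G.dist u w
  refine ⟨u, fun c ↦ ?_⟩
  obtain ⟨v, huv, hv⟩ := hG.connected.exists_adj_mem_supp_induce_ne u c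
  let A : Finset V := {w | w ∈ Subtype.val '' c.supp}
  have hA : Nat.card c.supp = A.card := by
    rw [← Nat.card_image_of_injective Subtype.val_injective, Nat.card_eq_card_toFinset]
    congr 1
    ext w
    simp [A]
  have hdist (w : V) : G.dist v w + 2 * (if w ∈ A then 1 else 0) ≤ G.dist u w + 1 := by
    split_ifs with hw
    · obtain ⟨x, hx, rfl⟩ := (Finset.mem_filter.mp hw).2
      have := hG.isAcyclic.dist_add_one_le_of_reachable_induce_ne huv
        (c.reachable_of_mem_supp hv hx)
      omega
    · have := hG.connected.dist_triangle (u := (v : V)) (v := u) (w := w)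
      rw [SimpleGraph.dist_eq_one_iff_adj.mpr huv.symm] at this
      omega
  have hsum := Finset.sum_le_sum fun w (_ : w ∈ Finset.univ) ↦ hdist w
  simp only [Finset.sum_add_distrib, ← Finset.mul_sum, Finset.sum_boole, Finset.filter_univ_mem,
    Finset.sum_const, Finset.card_univ, Nat.cast_id, smul_eq_mul, mul_one] at hsum
  have := hu v
  rw [hA]
  omega
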